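/- arXiv:2311.09332 — 2 statements merged into one kernel-verified Lean document; each statement's English description precedes it below -/
import Mathlib

section
/- Let f : ℝ → ℝ be infinitely differentiable and let x ∈ ℝ be a critical point of order 2, i.e. f′(x) = f″(x) = 0 and f‴(x) ≠ 0. Then lim_{Δx → 0⁺} τ⁺(x,Δx)/((τ⁺(x,Δx) + β̄⁺(x,Δx))·Δx) = (103/29)·|f⁽⁴⁾(x)/f‴(x)|; in particular the right-boundary WENO-ZC accelerating factor satisfies τ⁺/(τ⁺ + β̄⁺) = O(Δx) as Δx → 0⁺ at second-order critical points. -/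
open Filter Topology

/-- The Jiang--Shu smoothness indicators `β₀, β₁, β₂`. -/
noncomputable def wenoBeta (f : ℝ → ℝ) (x Δx : ℝ) : Fin 3 → ℝ
  | 0 => (1 / 4) * (f (x - 2 * Δx) - 4 * f (x - Δx) + 3 * f x) ^ 2
       + (13 / 12) * (f (x - 2 * Δx) - 2 * f (x - Δx) + f x) ^ 2
  | 1 => (1 / 4) * (f (x + Δx) - f (x - Δx)) ^ 2
       + (13 / 12) * (f (x - Δx) - 2 * f x + f (x + Δx)) ^ 2
  | 2 => (1 / 4) * (3 * f x - 4 * f (x + Δx) + f (x + 2 * Δx)) ^ 2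
       + (13 / 12) * (f x - 2 * f (x + Δx) + f (x + 2 * Δx)) ^ 2

/-- The global smoothness indicator `τ(x,Δx) = |β₂(x,Δx) − β₀(x,Δx)|`. -/
noncomputable def wenoTau (f : ℝ → ℝ) (x Δx : ℝ) : ℝ :=
  |wenoBeta f x Δx 2 - wenoBeta f x Δx 0|

/-- The mean smoothness indicator `β̄(x,Δx) = (β₀ + β₁ + β₂)/3`. -/
noncomputable def wenoBetaBar (f : ℝ → ℝ) (x Δx : ℝ) : ℝ :=
  (wenoBeta f x Δx 0 + wenoBeta f x Δx 1 + wenoBeta f x Δx 2) / 3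

theorem weno_taylor_aux (f : ℝ → ℝ) (hf : ContDiff ℝ (⊤ : ℕ∞) f) (x : ℝ)
    (h1 : deriv f x = 0) (h2 : iteratedDeriv 2 f x = 0) :
    ∃ B : ℝ → ℝ, Tendsto B (𝓝[≠] 0) (𝓝 (iteratedDeriv 4 f x / 24)) ∧
      ∀ h, h ≠ 0 → f (x + h) = f x + iteratedDeriv 3 f x / 6 * h ^ 3 + B h * h ^ 4 := by
  refine ⟨fun h => (f (x + h) - f x - iteratedDeriv 3 f x / 6 * h ^ 3) / h ^ 4, ?_, ?_⟩
  · have hf4 : ContDiff ℝ (4 : ℕ) f := hf.of_le (WithTop.coe_le_coe.2 (le_top : ((4 : ℕ) : ℕ∞) ≤ ⊤))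
    have h := (taylor_isLittleO_univ (x₀ := x) hf4).tendsto_div_nhds_zero
    have hm : Tendsto (fun h : ℝ => x + h) (𝓝[≠] 0) (𝓝 x) := by
      have : Tendsto (fun h : ℝ => x + h) (𝓝 0) (𝓝 (x + 0)) := by
        exact (continuous_const.add continuous_id).tendsto 0
      rw [add_zero] at this
      exact this.mono_left nhdsWithin_le_nhds
    have h' := (h.comp hm).add_const (iteratedDeriv 4 f x / 24)
    rw [zero_add] at h'
    refine h'.congr' ?_
    filter_upwards [self_mem_nhdsWithin] with t ht
    have ht' : t ≠ 0 := ht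
    simp only [Function.comp, taylor_within_apply, Finset.sum_range_succ, Finset.sum_range_zero,
      iteratedDerivWithin_univ, iteratedDeriv_one, h1, h2, iteratedDeriv_zero, smul_eq_mul,
      add_sub_cancel_left, Nat.factorial]
    push_cast
    field_simp
    ring
  · intro h hh
    field_simp
    ring

theorem weno_alg_aux (f : ℝ → ℝ) (x : ℝ) (a : ℝ) (B : ℝ → ℝ)
    (hB : ∀ h, h ≠ 0 → f (x + h) = f x + a * h ^ 3 + B h * h ^ 4) (h : ℝ) (hh : h ≠ 0) :
    wenoBeta f x h 0 = h ^ 6 * ((1 / 4) * (-4 * a + h * (16 * B (-2 * h) - 4 * B (-1 * h))) ^ 2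
      + (13 / 12) * (-6 * a + h * (16 * B (-2 * h) - 2 * B (-1 * h))) ^ 2) ∧
    wenoBeta f x h 1 = h ^ 6 * ((1 / 4) * (2 * a + h * (B (1 * h) - B (-1 * h))) ^ 2
      + (13 / 12) * (h * (B (1 * h) + B (-1 * h))) ^ 2) ∧
    wenoBeta f x h 2 = h ^ 6 * ((1 / 4) * (4 * a + h * (16 * B (2 * h) - 4 * B (1 * h))) ^ 2
      + (13 / 12) * (6 * a + h * (16 * B (2 * h) - 2 * B (1 * h))) ^ 2) := by
  have e1 := hB (1 * h) (by simpa using hh)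
  have e2 := hB (2 * h) (by simpa using hh)
  have e3 := hB (-1 * h) (by simpa using hh)
  have e4 := hB (-2 * h) (by simpa using hh)
  have r1 : x + h = x + 1 * h := by ring
  have r3 : x - h = x + -1 * h := by ring
  have r4 : x - 2 * h = x + -2 * h := by ring
  simp only [wenoBeta]
  rw [r3, r4, r1, e1, e2, e3, e4]
  refine ⟨?_, ?_, ?_⟩ <;> ring

theorem weno_div_aux (h : ℝ) {T S D E : ℝ} (hh : 0 < h) (hD : D = h ^ 7 * T)
    (hE : E = h ^ 6 * S) : |D| / ((|D| + E) * h) = |T| / (h * |T| + S) := by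
  have hp : 0 < h ^ 7 := by positivity
  rw [hD, hE, abs_mul, abs_of_pos hp, ← mul_div_mul_left |T| _ hp.ne']
  congr 1
  ring

/-- at a second-order critical point (`f′(x) = f″(x) = 0`,
`f‴(x) ≠ 0`), `τ⁺/((τ⁺ + β̄⁺)·Δx) → (103/29)·|f⁽⁴⁾/f‴|` as `Δx → 0⁺`;
in particular the right-boundary accelerating factor is `O(Δx)`. -/
theorem weno_zc_accelerator_second_order_critical_point_plus
    (f : ℝ → ℝ) (hf : ContDiff ℝ (⊤ : ℕ∞) f) (x : ℝ)
    (h1 : deriv f x = 0) (h2 : iteratedDeriv 2 f x = 0)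
    (h3 : iteratedDeriv 3 f x ≠ 0) :
    Tendsto (fun Δx : ℝ =>
        wenoTau f x Δx / ((wenoTau f x Δx + wenoBetaBar f x Δx) * Δx))
      (𝓝[>] 0)
      (𝓝 ((103 / 29) * |iteratedDeriv 4 f x / iteratedDeriv 3 f x|)) ∧
    (∃ C > (0 : ℝ), ∃ δ > (0 : ℝ), ∀ Δx : ℝ, 0 < Δx → Δx < δ →
      |wenoTau f x Δx / (wenoTau f x Δx + wenoBetaBar f x Δx)| ≤ C * Δx) := by
  obtain ⟨B, hBt, hB⟩ := weno_taylor_aux f hf x h1 h2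
  set a := iteratedDeriv 3 f x / 6 with ha
  set b := iteratedDeriv 4 f x / 24 with hb
  have ha0 : a ≠ 0 := by rw [ha]; positivity
  have hc : ∀ c : ℝ, c ≠ 0 → Tendsto (fun h : ℝ => B (c * h)) (𝓝[>] 0) (𝓝 b) := by
    intro c hc
    refine hBt.comp ?_
    refine tendsto_nhdsWithin_iff.2 ⟨?_, ?_⟩
    · have : Tendsto (fun h : ℝ => c * h) (𝓝 0) (𝓝 (c * 0)) :=
        (continuous_const.mul continuous_id).tendsto 0
      rw [mul_zero] at this
      exact this.mono_left nhdsWithin_le_nhds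
    · filter_upwards [self_mem_nhdsWithin] with h hh
      exact mul_ne_zero hc (ne_of_gt hh)
  have c1 := hc 1 (by norm_num)
  have c2 := hc 2 (by norm_num)
  have c3 := hc (-1) (by norm_num)
  have c4 := hc (-2) (by norm_num)
  have hid : Tendsto (fun h : ℝ => h) (𝓝[>] 0) (𝓝 0) :=
    tendsto_id.mono_left nhdsWithin_le_nhds
  have main : Tendsto (fun Δx : ℝ =>
        wenoTau f x Δx / ((wenoTau f x Δx + wenoBetaBar f x Δx) * Δx))
      (𝓝[>] 0)
      (𝓝 ((103 / 29) * |iteratedDeriv 4 f x / iteratedDeriv 3 f x|)) := by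
    have u := (c2.const_mul 16).sub (c1.const_mul 4)
    have v := (c4.const_mul 16).sub (c3.const_mul 4)
    have w := (c2.const_mul 16).sub (c1.const_mul 2)
    have z := (c4.const_mul 16).sub (c3.const_mul 2)
    have T := (((u.add v).mul ((hid.mul (u.sub v)).const_add (8 * a))).const_mul (1 / 4)).add
      (((w.add z).mul ((hid.mul (w.sub z)).const_add (12 * a))).const_mul (13 / 12))
    have b0 := ((((hid.mul v).const_add (-4 * a)).pow 2).const_mul (1 / 4)).add
      ((((hid.mul z).const_add (-6 * a)).pow 2).const_mul (13 / 12))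
    have b1 := ((((hid.mul (c1.sub c3)).const_add (2 * a)).pow 2).const_mul (1 / 4)).add
      (((hid.mul (c1.add c3)).pow 2).const_mul (13 / 12))
    have b2 := ((((hid.mul u).const_add (4 * a)).pow 2).const_mul (1 / 4)).add
      ((((hid.mul w).const_add (6 * a)).pow 2).const_mul (13 / 12))
    have S := ((b0.add b1).add b2).div_const 3
    have R := T.abs.div ((hid.mul T.abs).add S) (by
      have : 0 < a ^ 2 := by positivity
      apply ne_of_gt
      ring_nf
      positivity)
    have hlim : (103 / 29) * |iteratedDeriv 4 f x / iteratedDeriv 3 f x|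
        = |412 * (a * b)| / (29 * a ^ 2) := by
      have e4 : iteratedDeriv 4 f x = 24 * b := by rw [hb]; ring
      have e3 : iteratedDeriv 3 f x = 6 * a := by rw [ha]; ring
      rw [e4, e3, abs_div, abs_mul, abs_mul, abs_mul, abs_mul, ← sq_abs a]
      have : |a| ≠ 0 := abs_ne_zero.2 ha0
      norm_num
      field_simp
      rw [sq_abs]
      ring
    rw [hlim]
    refine (R.congr' ?_).trans (le_of_eq ?_)
    · filter_upwards [self_mem_nhdsWithin] with h hh
      have hh0 : 0 < h := hh
      obtain ⟨q0, q1, q2⟩ := weno_alg_aux f x a B hB h hh0.ne'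
      have key := weno_div_aux h (D := wenoBeta f x h 2 - wenoBeta f x h 0)
        (E := wenoBetaBar f x h) hh0
        (T := 1 / 4 * ((16 * B (2 * h) - 4 * B (1 * h) + (16 * B (-2 * h) - 4 * B (-1 * h))) *
            (8 * a + h * (16 * B (2 * h) - 4 * B (1 * h) - (16 * B (-2 * h) - 4 * B (-1 * h)))))
          + 13 / 12 * ((16 * B (2 * h) - 2 * B (1 * h) + (16 * B (-2 * h) - 2 * B (-1 * h))) *
            (12 * a + h * (16 * B (2 * h) - 2 * B (1 * h) - (16 * B (-2 * h) - 2 * B (-1 * h))))))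
        (by rw [q0, q2]; ring) (by rw [wenoBetaBar, q0, q1, q2, ← mul_add, ← mul_add, mul_div_assoc])
      exact key.symm
    · congr 1
      congr 1
      · congr 1
        ring
      · ring
  refine ⟨main, ?_⟩
  set L := (103 / 29) * |iteratedDeriv 4 f x / iteratedDeriv 3 f x| with hL
  have hL0 : 0 ≤ L := by positivity
  have hev := main.abs.eventually (gt_mem_nhds (show |L| < L + 1 by rw [abs_of_nonneg hL0]; linarith))
  obtain ⟨δ, hδ, hs⟩ := mem_nhdsGT_iff_exists_Ioo_subset.1 hev
  refine ⟨L + 1, by positivity, δ, hδ, fun h hh hhδ => ?_⟩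
  have hk : |wenoTau f x h / ((wenoTau f x h + wenoBetaBar f x h) * h)| < L + 1 := hs ⟨hh, hhδ⟩
  rw [← div_div, abs_div, abs_of_pos hh, div_lt_iff₀ hh] at hk
  exact hk.le
end

section
/- Let f : ℝ → ℝ be infinitely differentiable, let x ∈ ℝ be a critical point of order 1 (f′(x) = 0 and f″(x) ≠ 0), and let p > 0 be a real exponent. Then the WENO-ZC weights are well defined for all sufficiently small Δx > 0 and satisfy, for each k ∈ {0,1,2} and each choice of sign, ω_k^{ZC,±}(x,Δx) = d_k + O(Δx^{2p}) as Δx → 0⁺. -/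
/-- The ideal weights `(d₀, d₁, d₂) = (1/10, 6/10, 3/10)`. -/
noncomputable def wenoD : Fin 3 → ℝ
  | 0 => 1 / 10
  | 1 => 6 / 10
  | 2 => 3 / 10

/-- The centering coefficients `(c₀, c₁, c₂) = (3/4, 3/2, 3/4)`. -/
noncomputable def wenoCk : Fin 3 → ℝ
  | 0 => 3 / 4
  | 1 => 3 / 2
  | 2 => 3 / 4

/-- The unnormalized WENO-ZC weights (with `ε = 0` and real exponent `p`):
`α_k^{ZC} = d_k·[1 + c_k·(τ/β_k)^p·(τ/(τ + β̄))^p]`. -/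
noncomputable def alphaZC (p : ℝ) (f : ℝ → ℝ) (x Δx : ℝ) (k : Fin 3) : ℝ :=
  wenoD k * (1 + wenoCk k * (wenoTau f x Δx / wenoBeta f x Δx k) ^ p *
    (wenoTau f x Δx / (wenoTau f x Δx + wenoBetaBar f x Δx)) ^ p)

/-- The normalized WENO-ZC weights. -/
noncomputable def omegaZC (p : ℝ) (f : ℝ → ℝ) (x Δx : ℝ) (k : Fin 3) : ℝ :=
  alphaZC p f x Δx k / (∑ j : Fin 3, alphaZC p f x Δx j)

lemma weno_taylor (f : ℝ → ℝ) (hf : ContDiff ℝ (⊤ : ℕ∞) f) (x : ℝ) (h1 : deriv f x = 0) :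
    ∃ K > (0 : ℝ), ∀ t : ℝ, |t| ≤ 1 →
      |f (x + t) - f x - iteratedDeriv 2 f x / 2 * t ^ 2| ≤ K * |t| ^ 3 := by
  have hn : ∀ n : ℕ, ContDiff ℝ n f := contDiff_infty.1 hf
  have hc : Continuous (iteratedDeriv 3 f) :=
    (hn 3).continuous_iteratedDeriv 3 le_rfl
  obtain ⟨K, hK⟩ := (isCompact_Icc (a := x - 1) (b := x + 1)).exists_bound_of_continuousOn
    hc.continuousOn
  refine ⟨|K| + 1, by positivity, fun t ht => ?_⟩
  rcases eq_or_ne t 0 with rfl | h0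
  · simp
  have hne : x ≠ x + t := by simpa using h0
  obtain ⟨z, hz, h⟩ := taylor_mean_remainder_lagrange_iteratedDeriv (n := 2) hne
    (by exact_mod_cast (hn 3).contDiffOn)
  have hu : UniqueDiffOn ℝ (Set.uIcc x (x + t)) := uniqueDiffOn_uIcc hne
  have hm : x ∈ Set.uIcc x (x + t) := Set.left_mem_uIcc
  have e1 : iteratedDerivWithin 1 f (Set.uIcc x (x + t)) x = 0 := by
    rw [iteratedDerivWithin_eq_iteratedDeriv hu (hn 1).contDiffAt hm,
      iteratedDeriv_one, h1]
  have e2 : iteratedDerivWithin 2 f (Set.uIcc x (x + t)) x = iteratedDeriv 2 f x :=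
    iteratedDerivWithin_eq_iteratedDeriv hu (hn 2).contDiffAt hm
  rw [taylorWithinEval_succ, taylorWithinEval_succ, taylor_within_zero_eval] at h
  norm_num [e1, e2, Nat.factorial] at h
  have h' : f (x + t) - f x - iteratedDeriv 2 f x / 2 * t ^ 2 = iteratedDeriv 3 f z * t ^ 3 / 6 := by
    rw [← h]; ring
  have hzm : z ∈ Set.Icc (x - 1) (x + 1) := by
    have := Set.uIoo_subset_uIcc_self hz
    rw [Set.mem_uIcc] at this
    rw [abs_le] at ht
    constructor <;> rcases this with h | h <;> linarith [h.1, h.2]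
  have hb := hK z hzm
  rw [Real.norm_eq_abs] at hb
  rw [h', abs_div, abs_mul, abs_pow]
  have : |iteratedDeriv 3 f z| ≤ |K| + 1 := by linarith [le_abs_self K]
  have h6 : |(6:ℝ)| = 6 := by norm_num
  rw [h6]
  have := mul_le_mul_of_nonneg_right this (by positivity : 0 ≤ |t| ^ 3)
  have : 0 ≤ |iteratedDeriv 3 f z| * |t| ^ 3 := by positivity
  linarith

lemma weno_sq (P a L D : ℝ) (hD : 0 < D) (hD1 : D ≤ 1) (h : |P - 2 * a * D ^ 2| ≤ L * D ^ 3) :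
    |P ^ 2 - 4 * a ^ 2 * D ^ 4| ≤ L * (4 * |a| + L) * D ^ 5 := by
  have hL : 0 ≤ L := by
    have h3 : 0 < D ^ 3 := by positivity
    by_contra hn
    push Not at hn
    have := abs_nonneg (P - 2 * a * D ^ 2)
    nlinarith
  have e : P ^ 2 - 4 * a ^ 2 * D ^ 4 = (P - 2 * a * D ^ 2) * ((P - 2 * a * D ^ 2) + 4 * a * D ^ 2) := by
    ring
  have h2 : |(P - 2 * a * D ^ 2) + 4 * a * D ^ 2| ≤ (4 * |a| + L) * D ^ 2 := by
    refine (abs_add_le _ _).trans ?_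
    have : |4 * a * D ^ 2| = 4 * |a| * D ^ 2 := by
      rw [abs_mul, abs_mul]; simp
    rw [this]
    have : L * D ^ 3 ≤ L * D ^ 2 :=
      mul_le_mul_of_nonneg_left (pow_le_pow_of_le_one hD.le hD1 (by norm_num)) hL
    linarith
  rw [e, abs_mul]
  calc _ ≤ (L * D ^ 3) * ((4 * |a| + L) * D ^ 2) := by gcongr
    _ = _ := by ring

lemma weno_beta_aux (P Q a b L D : ℝ) (hD : 0 < D) (hD1 : D ≤ 1)
    (h : |P - 2 * b * D ^ 2| ≤ L * D ^ 3) (h' : |Q - 2 * a * D ^ 2| ≤ L * D ^ 3) :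
    |((1 / 4) * P ^ 2 + (13 / 12) * Q ^ 2) - (b ^ 2 + 13 / 3 * a ^ 2) * D ^ 4| ≤
      (L * (4 * |b| + L) / 4 + 13 / 12 * (L * (4 * |a| + L))) * D ^ 5 := by
  have i1 := weno_sq P b L D hD hD1 h
  have i2 := weno_sq Q a L D hD hD1 h'
  rw [abs_le] at *
  constructor <;> linarith [i1.1, i1.2, i2.1, i2.2]

lemma weno_core (p : ℝ) (hp : 0 < p) (f : ℝ → ℝ) (y D B W : ℝ) (hD : 0 < D) (hB : 0 < B)
    (hW : 0 < W) (hs : 2 * W * D ≤ B)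
    (h : ∀ k, |wenoBeta f y D k - B * D ^ 4| ≤ W * D ^ 5) :
    (∀ k, wenoBeta f y D k ≠ 0) ∧ wenoTau f y D + wenoBetaBar f y D ≠ 0 ∧
    (∑ j : Fin 3, alphaZC p f y D j) ≠ 0 ∧
    ∀ k, |omegaZC p f y D k - wenoD k| ≤ (3 / 2 * ((4 * W / B) ^ p * (4 * W / B) ^ p)) * D ^ (2 * p) := by
  have hD4 : 0 < D ^ 4 := by positivity
  have hlow : ∀ k, B / 2 * D ^ 4 ≤ wenoBeta f y D k := by
    intro k
    have h1 := (abs_le.1 (h k)).1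
    have := mul_le_mul_of_nonneg_right hs hD4.le
    nlinarith
  have hc : 0 < B / 2 * D ^ 4 := by positivity
  have hpos : ∀ k, 0 < wenoBeta f y D k := fun k => hc.trans_le (hlow k)
  have ht0 : 0 ≤ wenoTau f y D := abs_nonneg _
  have ht : wenoTau f y D ≤ 2 * W * D ^ 5 := by
    have a := abs_le.1 (h 0)
    have b := abs_le.1 (h 2)
    unfold wenoTau
    rw [abs_le]
    constructor <;> linarith [a.1, a.2, b.1, b.2]
  have hbar : B / 2 * D ^ 4 ≤ wenoBetaBar f y D := by
    unfold wenoBetaBar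
    linarith [hlow 0, hlow 1, hlow 2]
  have hq : ∀ z, B / 2 * D ^ 4 ≤ z → 0 ≤ wenoTau f y D / z ∧ wenoTau f y D / z ≤ 4 * W / B * D := by
    intro z hz
    have hz0 := hc.trans_le hz
    refine ⟨by positivity, ?_⟩
    rw [div_le_iff₀ hz0]
    calc _ ≤ 2 * W * D ^ 5 := ht
      _ = 4 * W / B * D * (B / 2 * D ^ 4) := by field_simp; ring
      _ ≤ _ := by gcongr
  have hpw : ∀ z, B / 2 * D ^ 4 ≤ z → 0 ≤ (wenoTau f y D / z) ^ p ∧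
      (wenoTau f y D / z) ^ p ≤ (4 * W / B) ^ p * D ^ p := by
    intro z hz
    obtain ⟨q1, q2⟩ := hq z hz
    refine ⟨Real.rpow_nonneg q1 _, ?_⟩
    rw [← Real.mul_rpow (by positivity) hD.le]
    exact Real.rpow_le_rpow q1 q2 hp.le
  set E := (3 / 2 * ((4 * W / B) ^ p * (4 * W / B) ^ p)) * D ^ (2 * p) with hE
  have hD2 : D ^ (2 * p) = D ^ p * D ^ p := by
    rw [← Real.rpow_add hD]; ring_nf
  have hα : ∀ k, ∃ e, 0 ≤ e ∧ e ≤ E ∧ alphaZC p f y D k = wenoD k * (1 + e) := by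
    intro k
    obtain ⟨a1, a2⟩ := hpw _ (hlow k)
    obtain ⟨b1, b2⟩ := hpw (wenoTau f y D + wenoBetaBar f y D) (by linarith)
    have c0 : 0 ≤ wenoCk k := by fin_cases k <;> norm_num [wenoCk]
    have c1 : wenoCk k ≤ 3 / 2 := by fin_cases k <;> norm_num [wenoCk]
    refine ⟨_, ?_, ?_, rfl⟩
    · positivity
    · rw [hE, hD2]
      calc _ ≤ 3 / 2 * ((4 * W / B) ^ p * D ^ p) * ((4 * W / B) ^ p * D ^ p) := by gcongr
        _ = _ := by ring
  obtain ⟨e0, p0, l0, h0⟩ := hα 0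
  obtain ⟨e1, p1, l1, h1⟩ := hα 1
  obtain ⟨e2, p2, l2, h2⟩ := hα 2
  have hsum : (∑ j : Fin 3, alphaZC p f y D j) = 1 + (e0 / 10 + 6 / 10 * e1 + 3 / 10 * e2) := by
    rw [Fin.sum_univ_three, h0, h1, h2]
    simp only [wenoD]; ring
  have hS : 0 < 1 + (e0 / 10 + 6 / 10 * e1 + 3 / 10 * e2) := by positivity
  refine ⟨fun k => (hpos k).ne', by linarith, by rw [hsum]; exact hS.ne', fun k => ?_⟩
  obtain ⟨e, q0, q1, hk⟩ := hα k
  have d0 : 0 ≤ wenoD k := by fin_cases k <;> norm_num [wenoD]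
  have d1 : wenoD k ≤ 1 := by fin_cases k <;> norm_num [wenoD]
  unfold omegaZC
  rw [hsum, hk]
  generalize hs' : (e0 / 10 + 6 / 10 * e1 + 3 / 10 * e2) = s at *
  have s0 : 0 ≤ s := by rw [← hs']; positivity
  have s1 : s ≤ E := by rw [← hs']; linarith
  have : wenoD k * (1 + e) / (1 + s) - wenoD k = wenoD k * ((e - s) / (1 + s)) := by
    field_simp; ring
  rw [this, abs_mul, abs_div, abs_of_nonneg d0, abs_of_pos hS]
  have i1 : |e - s| ≤ E := abs_le.2 ⟨by linarith, by linarith⟩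
  have i2 : |e - s| / (1 + s) ≤ E :=
    (div_le_self (abs_nonneg _) (by linarith)).trans i1
  calc _ ≤ 1 * E := by gcongr
    _ = E := one_mul _

/-- at a first-order critical point (`f′(x) = 0`, `f″(x) ≠ 0`),
the WENO-ZC weights are well defined for all sufficiently small `Δx > 0`
(nonvanishing denominators) and satisfy `ω_k^{ZC,±} = d_k + O(Δx^{2p})` as
`Δx → 0⁺` for every `k` and each choice of sign (the left-boundary quantities
are those based at `x − Δx`). -/
theorem weno_zc_weights_first_order_critical_point
    (f : ℝ → ℝ) (hf : ContDiff ℝ (⊤ : ℕ∞) f) (x : ℝ) (h1 : deriv f x = 0) (h2 : iteratedDeriv 2 f x ≠ 0)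
    (p : ℝ) (hp : 0 < p) :
    ∃ δ > (0 : ℝ),
      (∀ Δx : ℝ, 0 < Δx → Δx < δ →
        (∀ k : Fin 3, wenoBeta f x Δx k ≠ 0) ∧
        (∀ k : Fin 3, wenoBeta f (x - Δx) Δx k ≠ 0) ∧
        wenoTau f x Δx + wenoBetaBar f x Δx ≠ 0 ∧
        wenoTau f (x - Δx) Δx + wenoBetaBar f (x - Δx) Δx ≠ 0 ∧
        (∑ j : Fin 3, alphaZC p f x Δx j) ≠ 0 ∧
        (∑ j : Fin 3, alphaZC p f (x - Δx) Δx j) ≠ 0) ∧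
      ∀ k : Fin 3, ∃ C > (0 : ℝ), ∀ Δx : ℝ, 0 < Δx → Δx < δ →
        |omegaZC p f x Δx k - wenoD k| ≤ C * Δx ^ (2 * p) ∧
        |omegaZC p f (x - Δx) Δx k - wenoD k| ≤ C * Δx ^ (2 * p) := by
  obtain ⟨K, hK, hT⟩ := weno_taylor f hf x h1
  set a := iteratedDeriv 2 f x / 2 with ha
  have ha0 : a ≠ 0 := by rw [ha]; exact div_ne_zero h2 two_ne_zero
  have ha2 : 0 < a ^ 2 := by positivity
  obtain ⟨L, hL⟩ : ∃ L, L = 300 * K := ⟨_, rfl⟩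
  have hL0 : 0 < L := by rw [hL]; positivity
  have hV : ∀ D : ℝ, 0 < D → D ≤ 1 / 3 → ∀ m : ℝ, |m| ≤ 3 →
      |f (x + m * D) - f x - a * (m * D) ^ 2| ≤ 27 * K * D ^ 3 := by
    intro D hD hD3 m hm
    have e : |m * D| = |m| * D := by rw [abs_mul, abs_of_pos hD]
    have h3 : |m * D| ≤ 3 * D := by rw [e]; gcongr
    refine (hT (m * D) (by linarith)).trans ?_
    calc _ ≤ K * (3 * D) ^ 3 := by gcongr
      _ = _ := by ring
  obtain ⟨Wf, hWf⟩ : ∃ Wf : ℝ → ℝ,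
    Wf = fun b => L * (4 * |b| + L) / 4 + 13 / 12 * (L * (4 * |a| + L)) := ⟨_, rfl⟩
  have hW : ∀ b, 0 < Wf b := by intro b; rw [hWf]; positivity
  have hβ : ∀ D : ℝ, 0 < D → D ≤ 1 / 3 →
      (∀ k, |wenoBeta f x D k - (0 ^ 2 + 13 / 3 * a ^ 2) * D ^ 4| ≤ Wf 0 * D ^ 5) ∧
      (∀ k, |wenoBeta f (x - D) D k - ((-2 * a) ^ 2 + 13 / 3 * a ^ 2) * D ^ 4| ≤
        Wf (-2 * a) * D ^ 5) := by
    intro D hD hD3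
    have v3 := abs_le.1 (hV D hD hD3 (-3) (by norm_num))
    have v2 := abs_le.1 (hV D hD hD3 (-2) (by norm_num))
    have v1 := abs_le.1 (hV D hD hD3 (-1) (by norm_num))
    have w1 := abs_le.1 (hV D hD hD3 1 (by norm_num))
    have w2 := abs_le.1 (hV D hD hD3 2 (by norm_num))
    have r3 : x + -3 * D = x - 3 * D := by ring
    have r2 : x + -2 * D = x - 2 * D := by ring
    have r1 : x + -1 * D = x - D := by ring
    have s1 : x + 1 * D = x + D := by ring
    rw [r3] at v3
    rw [r2] at v2
    rw [r1] at v1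
    rw [s1] at w1
    have t1 : x - D - 2 * D = x - 3 * D := by ring
    have t2 : x - D - D = x - 2 * D := by ring
    have t3 : x - D + D = x := by ring
    have t4 : x - D + 2 * D = x + D := by ring
    obtain ⟨v31, v32⟩ := v3
    obtain ⟨v21, v22⟩ := v2
    obtain ⟨v11, v12⟩ := v1
    obtain ⟨w11, w12⟩ := w1
    obtain ⟨w21, w22⟩ := w2
    have hKD : 0 < K * D ^ 3 := by positivity
    have hneg : ∀ P b, |P - 2 * b * D ^ 2| ≤ L * D ^ 3 → |(-P) - 2 * (-b) * D ^ 2| ≤ L * D ^ 3 := by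
      intro P b h
      rw [← abs_neg]; convert h using 2; ring
    rw [hWf]
    constructor
    · intro k
      fin_cases k
      · refine weno_beta_aux _ _ a 0 L D hD (by linarith) ?_ ?_ <;> rw [hL, abs_le] <;>
          constructor <;> linarith
      · refine weno_beta_aux _ _ a 0 L D hD (by linarith) ?_ ?_ <;> rw [hL, abs_le] <;>
          constructor <;> linarith
      · refine weno_beta_aux _ _ a 0 L D hD (by linarith) ?_ ?_ <;> rw [hL, abs_le] <;>
          constructor <;> linarith
    · intro k
      fin_cases k
      · refine weno_beta_aux _ _ a (-2 * a) L D hD (by linarith) ?_ ?_ <;>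
          rw [hL, abs_le, t1, t2] <;> constructor <;> linarith
      · refine weno_beta_aux _ _ a (-2 * a) L D hD (by linarith) ?_ ?_ <;>
          rw [hL, abs_le, t2, t3] <;> constructor <;> linarith
      · have := weno_beta_aux (-(3 * f (x - D) - 4 * f (x - D + D) + f (x - D + 2 * D)))
          (f (x - D) - 2 * f (x - D + D) + f (x - D + 2 * D)) a (-2 * a) L D hD (by linarith)
          (by rw [hL, abs_le, t3, t4]; constructor <;> linarith)
          (by rw [hL, abs_le, t3, t4]; constructor <;> linarith)
        rw [neg_sq] at this
        exact this
  have hB1 : 0 < (0:ℝ) ^ 2 + 13 / 3 * a ^ 2 := by positivity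
  have hB2 : 0 < (-2 * a) ^ 2 + 13 / 3 * a ^ 2 := by positivity
  generalize (0:ℝ) ^ 2 + 13 / 3 * a ^ 2 = B1 at *
  generalize (-2 * a) ^ 2 + 13 / 3 * a ^ 2 = B2 at *
  have hW1 := hW 0
  have hW2 := hW (-2 * a)
  generalize Wf 0 = W1 at *
  generalize Wf (-2 * a) = W2 at *
  have key : ∀ D : ℝ, 0 < D → D < min (1 / 3) (min (B1 / (2 * W1)) (B2 / (2 * W2))) → _ ∧ _ :=
    fun D hD hlt => by
      have l1 : D < 1 / 3 := hlt.trans_le (min_le_left _ _)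
      have l2 : D < B1 / (2 * W1) :=
        hlt.trans_le ((min_le_right _ _).trans (min_le_left _ _))
      have l3 : D < B2 / (2 * W2) :=
        hlt.trans_le ((min_le_right _ _).trans (min_le_right _ _))
      rw [lt_div_iff₀ (by positivity)] at l2 l3
      exact ⟨weno_core p hp f x D B1 W1 hD hB1 hW1 (by linarith) (hβ D hD l1.le).1,
        weno_core p hp f (x - D) D B2 W2 hD hB2 hW2 (by linarith) (hβ D hD l1.le).2⟩
  refine ⟨min (1 / 3) (min (B1 / (2 * W1)) (B2 / (2 * W2))), by positivity, ?_, ?_⟩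
  · intro D hD hlt
    obtain ⟨⟨x1, x2, x3, -⟩, y1, y2, y3, -⟩ := key D hD hlt
    exact ⟨x1, y1, x2, y2, x3, y3⟩
  · intro k
    refine ⟨(3 / 2 * ((4 * W1 / B1) ^ p * (4 * W1 / B1) ^ p)) +
      (3 / 2 * ((4 * W2 / B2) ^ p * (4 * W2 / B2) ^ p)), by positivity, fun D hD hlt => ?_⟩
    obtain ⟨⟨-, -, -, x4⟩, -, -, -, y4⟩ := key D hD hlt
    have hDp : 0 < D ^ (2 * p) := by positivity
    refine ⟨(x4 k).trans ?_, (y4 k).trans ?_⟩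
    · exact mul_le_mul_of_nonneg_right (le_add_of_nonneg_right (by positivity)) hDp.le
    · exact mul_le_mul_of_nonneg_right (le_add_of_nonneg_left (by positivity)) hDp.le
end
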